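/- arXiv:2207.03629 — 2 statements merged into one kernel-verified Lean document; each statement's English description precedes it below -/
import Mathlib

section
/- If (X,G) and (Y,H) are both chain recurrent free semigroup actions, then for all ε > 0, x ∈ X and y ∈ Y, the ε-chain recurrence times satisfy max{ r_ε(x,G), r_ε(y,H) } ≤ r_ε((x,y), G×H) ≤ lcm( r_ε(x,G), r_ε(y,H) ). -/
open Metric Filter Set
open scoped Classical

noncomputable section

variable {X : Type*} [MetricSpace X] {Y : Type*} [MetricSpace Y] {ι κ : Type*}

/-- `c` satisfies the `(w, δ)`-chain condition along the word `w`. -/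
def IsChainSeq (f : ι → X → X) (w : List ι) (δ : ℝ) (c : ℕ → X) : Prop :=
  ∀ (j : ℕ) (h : j < w.length), dist (f (w.get ⟨j, h⟩) (c j)) (c (j + 1)) ≤ δ

/-- There is a `(w, δ)`-chain from `a` to `b` with `|w| = n`. -/
def ChainFrom (f : ι → X → X) (δ : ℝ) (a b : X) (n : ℕ) : Prop :=
  ∃ w : List ι, w.length = n ∧ ∃ c : ℕ → X, IsChainSeq f w δ c ∧ c 0 = a ∧ c n = b

/-- `x` is a chain recurrent point of the action generated by `f`. -/
def ChainRecurrentPt (f : ι → X → X) (x : X) : Prop :=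
  ∀ ε : ℝ, 0 < ε → ∃ n : ℕ, 0 < n ∧ ChainFrom f ε x x n

/-- The action generated by `f` is chain recurrent. -/
def ChainRecurrent (f : ι → X → X) : Prop := ∀ x : X, ChainRecurrentPt f x

/-- The action generated by `f` is chain transitive. -/
def ChainTransitive (f : ι → X → X) : Prop :=
  ∀ ε : ℝ, 0 < ε → ∀ a b : X, ∃ n : ℕ, 0 < n ∧ ChainFrom f ε a b n

/-- The action generated by `f` is chain mixing. -/
def ChainMixing (f : ι → X → X) : Prop :=
  ∀ ε : ℝ, 0 < ε → ∃ N : ℕ, 0 < N ∧ ∀ a b : X, ∀ n : ℕ, N ≤ n → ChainFrom f ε a b n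

/-- The `ε`-chain recurrence time `r_ε(x, G)`. -/
def rTime (f : ι → X → X) (ε : ℝ) (x : X) : ℕ :=
  sInf {n : ℕ | 0 < n ∧ ChainFrom f ε x x n}

/-- `r_ε(G) = max_x r_ε(x, G)`. -/
def rTimeSup (f : ι → X → X) (ε : ℝ) : ℕ :=
  sSup (Set.range fun x : X => rTime f ε x)

/-- The chain mixing time `m_ε(x, δ, G)`. -/
def mTime (f : ι → X → X) (ε δ : ℝ) (x : X) : ℕ :=
  sInf {N : ℕ | ∀ n : ℕ, N ≤ n → ∀ y : X, ∃ z : X, dist z x < δ ∧ ChainFrom f ε z y n}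

/-- `m_ε(δ, G) = max_x m_ε(x, δ, G)`. -/
def mTimeSup (f : ι → X → X) (ε δ : ℝ) : ℕ :=
  sSup (Set.range fun x : X => mTime f ε δ x)

/-- `f_w = f_{i₀} ∘ f_{i₁} ∘ ⋯ ∘ f_{i_{k-1}}` applied to `x`. -/
def applyWord (f : ι → X → X) (w : List ι) (x : X) : X := w.foldr f x

/-- The generators of `G^k`, indexed by the words of length `k`. -/
def powerGens (f : ι → X → X) (k : ℕ) : (Fin k → ι) → X → X :=
  fun u => applyWord f (List.ofFn u)

/-- The generators `f_j × g_k` of the product action `G × H`. -/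
def prodGens (f : ι → X → X) (g : κ → Y → Y) : ι × κ → X × Y → X × Y :=
  fun p z => (f p.1 z.1, g p.2 z.2)

/-- `T_ε(x)`: the set of lengths of `(w, ε)`-chains from `x` to itself. -/
def Tset (f : ι → X → X) (ε : ℝ) (x : X) : Set ℕ :=
  {n : ℕ | 0 < n ∧ ChainFrom f ε x x n}

/-- `k = gcd T` for a set `T ⊆ ℕ`. -/
def IsGCDOf (T : Set ℕ) (k : ℕ) : Prop :=
  (∀ t ∈ T, k ∣ t) ∧ ∀ d : ℕ, (∀ t ∈ T, d ∣ t) → d ∣ k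

/-- `x ∼_ε y`: there is an `(w, ε)`-chain from `x` to `y` whose length is a multiple of `k`. -/
def RelEps (f : ι → X → X) (ε : ℝ) (k : ℕ) (x y : X) : Prop :=
  ∃ n : ℕ, 0 < n ∧ k ∣ n ∧ ChainFrom f ε x y n

/-- The orbit segment: the first `j` letters of `w` applied, in order, to `x`. -/
def orbitSeg (f : ι → X → X) (w : List ι) (x : X) (j : ℕ) : X :=
  (w.take j).foldl (fun y i => f i y) x

/-- The Bowen-type word metric `d_w`. -/
def wordDist (f : ι → X → X) (w : List ι) (x y : X) : ℝ :=
  ⨆ j : Fin (w.length + 1), dist (orbitSeg f w x (j : ℕ)) (orbitSeg f w y (j : ℕ))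

/-- `N(w, ε, G)`: maximal cardinality of a `(w, ε, G)`-separated subset of `X`. -/
def sepMax (f : ι → X → X) (w : List ι) (ε : ℝ) : ℕ :=
  sSup {k : ℕ | ∃ K : Finset X,
    (∀ x ∈ K, ∀ y ∈ K, x ≠ y → ε ≤ wordDist f w x y) ∧ K.card = k}

/-- Bufetov's topological entropy `h(G)` of a free semigroup action. -/
def topEntropy {m : ℕ} (f : Fin m → X → X) : ℝ :=
  ⨆ ε : {e : ℝ // 0 < e},
    Filter.limsup (fun n : ℕ =>
      Real.log ((∑ w : Fin n → Fin m, (sepMax f (List.ofFn w) ε.1 : ℝ)) / (m : ℝ) ^ n) / (n : ℝ))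
      Filter.atTop

/-- `N*(w, ε, δ, G)`: maximal cardinality of a `(w, ε, δ, G)`-pseudo-separated set. -/
def pseudoSepMax (f : ι → X → X) (w : List ι) (ε δ : ℝ) : ℕ :=
  sSup {k : ℕ | ∃ K : Finset (ℕ → X),
    (∀ c ∈ K, IsChainSeq f w δ c) ∧
    (∀ c ∈ K, ∀ c' ∈ K, c ≠ c' → ∃ j : ℕ, j < w.length ∧ ε < dist (c j) (c' j)) ∧
    K.card = k}

/-- `B*(w, ε, δ, G)`: minimal cardinality of a `(w, ε, δ, G)`-pseudo-spanning set. -/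
def pseudoSpanMin (f : ι → X → X) (w : List ι) (ε δ : ℝ) : ℕ :=
  sInf {k : ℕ | ∃ K : Finset (ℕ → X),
    (∀ c ∈ K, IsChainSeq f w δ c) ∧
    (∀ c : ℕ → X, IsChainSeq f w δ c →
      ∃ c' ∈ K, ∀ j : ℕ, j < w.length → dist (c j) (c' j) ≤ ε) ∧
    K.card = k}

/-- The pseudo-entropy `h*(G)` of a free semigroup action. -/
def pseudoEntropy {m : ℕ} (f : Fin m → X → X) : ℝ :=
  ⨆ ε : {e : ℝ // 0 < e}, ⨅ δ : {d : ℝ // 0 < d},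
    Filter.limsup (fun n : ℕ =>
      Real.log ((∑ w : Fin n → Fin m, (pseudoSepMax f (List.ofFn w) ε.1 δ.1 : ℝ)) / (m : ℝ) ^ n)
        / (n : ℝ)) Filter.atTop

/-- The metric `d'(ω, ω') = m^{-k}`, `k = inf {n | ωₙ ≠ ω'ₙ}`, on `Σ_m^+ = ℕ → Fin m`. -/
def sigmaDist (m : ℕ) (ω ω' : ℕ → Fin m) : ℝ :=
  if h : ∃ n : ℕ, ω n ≠ ω' n then (1 / (m : ℝ)) ^ Nat.find h else 0

/-- The metric `D = max {d', d}` on `Σ_m^+ × X`. -/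
def skewDist (m : ℕ) (p q : (ℕ → Fin m) × X) : ℝ :=
  max (sigmaDist m p.1 q.1) (dist p.2 q.2)

/-- The skew-product transformation `F(ω, x) = (σ ω, f_{ω 0} x)`. -/
def skewMap {m : ℕ} (f : Fin m → X → X) : (ℕ → Fin m) × X → (ℕ → Fin m) × X :=
  fun p => (fun n => p.1 (n + 1), f (p.1 0) p.2)

/-- `c` is a `δ`-pseudo-orbit of length `n + 1` of the single map `F`,
w.r.t. the distance function `D`. -/
def IsPseudoOrbit {Z : Type*} (D : Z → Z → ℝ) (F : Z → Z) (n : ℕ) (δ : ℝ) (c : ℕ → Z) : Prop :=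
  ∀ j : ℕ, j < n → D (F (c j)) (c (j + 1)) ≤ δ

/-- `N*(n, ε, δ, F)` for a single map `F` w.r.t. a distance function `D`. -/
def pseudoSepMaxMap {Z : Type*} (D : Z → Z → ℝ) (F : Z → Z) (n : ℕ) (ε δ : ℝ) : ℕ :=
  sSup {k : ℕ | ∃ K : Finset (ℕ → Z),
    (∀ c ∈ K, IsPseudoOrbit D F n δ c) ∧
    (∀ c ∈ K, ∀ c' ∈ K, c ≠ c' → ∃ j : ℕ, j < n ∧ ε < D (c j) (c' j)) ∧
    K.card = k}

/-- `B*(n, ε, δ, F)` for a single map `F` w.r.t. a distance function `D`. -/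
def pseudoSpanMinMap {Z : Type*} (D : Z → Z → ℝ) (F : Z → Z) (n : ℕ) (ε δ : ℝ) : ℕ :=
  sInf {k : ℕ | ∃ K : Finset (ℕ → Z),
    (∀ c ∈ K, IsPseudoOrbit D F n δ c) ∧
    (∀ c : ℕ → Z, IsPseudoOrbit D F n δ c →
      ∃ c' ∈ K, ∀ j : ℕ, j ≤ n → D (c j) (c' j) ≤ ε) ∧
    K.card = k}

/-- The pseudo-entropy `h*(F)` of a single map `F` w.r.t. a distance function `D`. -/
def pseudoEntropyMap {Z : Type*} (D : Z → Z → ℝ) (F : Z → Z) : ℝ :=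
  ⨆ ε : {e : ℝ // 0 < e}, ⨅ δ : {d : ℝ // 0 < d},
    Filter.limsup (fun n : ℕ =>
      Real.log (pseudoSepMaxMap D F n ε.1 δ.1 : ℝ) / (n : ℝ)) Filter.atTop

/-- An `ε`-chain of length `n` from `a` to `b` for a single map. -/
def ChainFromMap {Z : Type*} (D : Z → Z → ℝ) (F : Z → Z) (δ : ℝ) (a b : Z) (n : ℕ) : Prop :=
  ∃ c : ℕ → Z, IsPseudoOrbit D F n δ c ∧ c 0 = a ∧ c n = b

/-- `r_ε(z, F)` for a single map. -/
def rTimeMap {Z : Type*} (D : Z → Z → ℝ) (F : Z → Z) (ε : ℝ) (z : Z) : ℕ :=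
  sInf {n : ℕ | 0 < n ∧ ChainFromMap D F ε z z n}

/-- `r_ε(F)` for a single map. -/
def rTimeMapSup {Z : Type*} (D : Z → Z → ℝ) (F : Z → Z) (ε : ℝ) : ℕ :=
  sSup (Set.range fun z : Z => rTimeMap D F ε z)

/-- `m_ε(z, δ, F)` for a single map. -/
def mTimeMap {Z : Type*} (D : Z → Z → ℝ) (F : Z → Z) (ε δ : ℝ) (z : Z) : ℕ :=
  sInf {N : ℕ | ∀ n : ℕ, N ≤ n → ∀ y : Z, ∃ z' : Z, D z' z < δ ∧ ChainFromMap D F ε z' y n}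

/-- `m_ε(δ, F)` for a single map. -/
def mTimeMapSup {Z : Type*} (D : Z → Z → ℝ) (F : Z → Z) (ε δ : ℝ) : ℕ :=
  sSup (Set.range fun z : Z => mTimeMap D F ε δ z)

/-- `N_δ(X)`: the smallest number of sets of diameter at most `δ` that cover `X`. -/
def coverNum (X : Type*) [MetricSpace X] (δ : ℝ) : ℕ :=
  sInf {k : ℕ | ∃ S : Finset (Set X),
    (∀ s ∈ S, Metric.diam s ≤ δ) ∧ (⋃ s ∈ S, s) = Set.univ ∧ S.card = k}

/-- The upper box dimension of `X`. -/
def upperBoxDim (X : Type*) [MetricSpace X] : ℝ :=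
  Filter.limsup (fun δ : ℝ => Real.log (coverNum X δ : ℝ) / (-Real.log δ))
    (nhdsWithin 0 (Set.Ioi 0))

/-- The lower box dimension of `X`. -/
def lowerBoxDim (X : Type*) [MetricSpace X] : ℝ :=
  Filter.liminf (fun δ : ℝ => Real.log (coverNum X δ : ℝ) / (-Real.log δ))
    (nhdsWithin 0 (Set.Ioi 0))

end

theorem chainFrom_iff {X ι : Type*} [MetricSpace X] {f : ι → X → X} {δ : ℝ} {a b : X} {n : ℕ} :
    ChainFrom f δ a b n ↔ ∃ (u : Fin n → ι) (c : ℕ → X),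
      (∀ j : Fin n, dist (f (u j) (c j)) (c (j + 1)) ≤ δ) ∧ c 0 = a ∧ c n = b := by
  constructor
  · rintro ⟨w, rfl, c, hc, h0, hn⟩
    exact ⟨w.get, c, fun j => hc j j.2, h0, hn⟩
  · rintro ⟨u, c, hc, h0, hn⟩
    refine ⟨List.ofFn u, List.length_ofFn, c, fun j hj => ?_, h0, hn⟩
    simpa using hc ⟨j, by simpa using hj⟩

/-- A closed chain of positive length `k` can be repeated to any multiple of `k`. -/
theorem ChainFrom.of_dvd {X ι : Type*} [MetricSpace X] {f : ι → X → X} {δ : ℝ} {x : X} {k N : ℕ}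
    (h : ChainFrom f δ x x k) (hk : 0 < k) (hkN : k ∣ N) : ChainFrom f δ x x N := by
  obtain ⟨u, c, hc, h0, hn⟩ := chainFrom_iff.1 h
  refine chainFrom_iff.2 ⟨fun i => u ⟨i % k, Nat.mod_lt _ hk⟩, fun i => c (i % k),
    fun j => ?_, by simpa using h0, by simpa [Nat.mod_eq_zero_of_dvd hkN] using h0⟩
  have hstep : c ((j + 1) % k) = c (j % k + 1) := by
    rw [← Nat.mod_add_mod]
    rcases (Nat.succ_le_of_lt (Nat.mod_lt (j : ℕ) hk)).lt_or_eq with hlt | heq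
    · rw [Nat.mod_eq_of_lt hlt]
    · rw [show (j : ℕ) % k + 1 = k from heq, Nat.mod_self, h0, hn]
  simpa only [hstep] using hc ⟨j % k, Nat.mod_lt _ hk⟩

theorem chainFrom_prodGens_iff {X Y ι κ : Type*} [MetricSpace X] [MetricSpace Y]
    {f : ι → X → X} {g : κ → Y → Y} {δ : ℝ} {a b : X} {a' b' : Y} {n : ℕ} :
    ChainFrom (prodGens f g) δ (a, a') (b, b') n ↔
      ChainFrom f δ a b n ∧ ChainFrom g δ a' b' n := by
  simp only [chainFrom_iff]
  constructor
  · rintro ⟨u, c, hc, h0, hn⟩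
    simp only [Prod.dist_eq, max_le_iff] at hc
    exact ⟨⟨fun j => (u j).1, fun i => (c i).1, fun j => (hc j).1, by simp [h0], by simp [hn]⟩,
      ⟨fun j => (u j).2, fun i => (c i).2, fun j => (hc j).2, by simp [h0], by simp [hn]⟩⟩
  · rintro ⟨⟨u, c, hc, h0, hn⟩, ⟨v, d, hd, h0', hn'⟩⟩
    exact ⟨fun j => (u j, v j), fun i => (c i, d i), fun j => max_le (hc j) (hd j),
      by simp [h0, h0'], by simp [hn, hn']⟩

theorem ChainRecurrentPt.rTime_spec {X ι : Type*} [MetricSpace X] {f : ι → X → X} {x : X}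
    (h : ChainRecurrentPt f x) {ε : ℝ} (hε : 0 < ε) :
    0 < rTime f ε x ∧ ChainFrom f ε x x (rTime f ε x) :=
  Nat.sInf_mem (s := {n : ℕ | 0 < n ∧ ChainFrom f ε x x n}) (h ε hε)

theorem rTime_le {X ι : Type*} [MetricSpace X] {f : ι → X → X} {ε : ℝ} {x : X} {n : ℕ}
    (hn : 0 < n) (h : ChainFrom f ε x x n) : rTime f ε x ≤ n :=
  Nat.sInf_le ⟨hn, h⟩

theorem stmt8 {X Y : Type*} [MetricSpace X] [MetricSpace Y] [CompactSpace X] [CompactSpace Y]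
    {m n : ℕ} (f : Fin m → X → X) (g : Fin n → Y → Y)
    (hf : ∀ i, Continuous (f i)) (hg : ∀ j, Continuous (g j))
    (hcrf : ChainRecurrent f) (hcrg : ChainRecurrent g) :
    ∀ ε : ℝ, 0 < ε → ∀ (x : X) (y : Y),
      max (rTime f ε x) (rTime g ε y) ≤ rTime (prodGens f g) ε (x, y) ∧
        rTime (prodGens f g) ε (x, y) ≤ Nat.lcm (rTime f ε x) (rTime g ε y) := by
  intro ε hε x y
  obtain ⟨hfpos, hfc⟩ := (hcrf x).rTime_spec hε
  obtain ⟨hgpos, hgc⟩ := (hcrg y).rTime_spec hε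
  have hpos := Nat.lcm_pos hfpos hgpos
  have hlcm : ChainFrom (prodGens f g) ε (x, y) (x, y) (Nat.lcm (rTime f ε x) (rTime g ε y)) :=
    chainFrom_prodGens_iff.2
      ⟨hfc.of_dvd hfpos (Nat.dvd_lcm_left _ _), hgc.of_dvd hgpos (Nat.dvd_lcm_right _ _)⟩
  refine ⟨?_, rTime_le hpos hlcm⟩
  obtain ⟨hppos, hpc⟩ := Nat.sInf_mem
    (s := {n : ℕ | 0 < n ∧ ChainFrom (prodGens f g) ε (x, y) (x, y) n}) ⟨_, hpos, hlcm⟩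
  obtain ⟨hx, hy⟩ := chainFrom_prodGens_iff.1 hpc
  exact max_le (rTime_le hppos hx) (rTime_le hppos hy)
end

section
/- Let G be a chain transitive free semigroup action on a compact metric space X. For every ε > 0, the equivalence relation ∼_ε on X is both open and closed (each equivalence class is a clopen subset of X, equivalently the relation is a clopen subset of X×X), and the equivalence relation ∼ is closed. -/
open Metric Filter Set
open scoped Classical

theorem ChainFrom.trans {X ι : Type*} [MetricSpace X] {f : ι → X → X} {δ : ℝ} {a b e : X}
    {n l : ℕ} (h₁ : ChainFrom f δ a b n) (h₂ : ChainFrom f δ b e l) :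
    ChainFrom f δ a e (n + l) := by
  obtain ⟨w, rfl, c, hc, hc0, hcn⟩ := h₁
  obtain ⟨v, rfl, d, hd, hd0, hdl⟩ := h₂
  refine ⟨w ++ v, by simp, fun j => if j < w.length then c j else d (j - w.length),
    ?_, ?_, by simpa using hdl⟩
  · intro j hj
    rcases lt_or_ge j w.length with hjw | hjw
    · have h := hc j hjw
      rcases Nat.lt_or_ge (j + 1) w.length with h' | h'
      · simpa [hjw, h', List.getElem_append_left] using h
      · have hjn : j + 1 = w.length := by omega
        rw [hjn, hcn, ← hd0] at h
        simpa [hjw, hjn, List.getElem_append_left] using h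
    · have hjv : j - w.length < v.length := by simp at hj; omega
      have h := hd (j - w.length) hjv
      have e₁ : ¬ j < w.length := by omega
      have e₂ : ¬ j + 1 < w.length := by omega
      have e₃ : j + 1 - w.length = j - w.length + 1 := by omega
      simpa [e₁, e₂, e₃, List.getElem_append_right hjw] using h
  · by_cases hw : 0 < w.length
    · simpa [hw] using hc0
    · have hw' : w.length = 0 := by omega
      rw [hw'] at hcn
      simp [hw', hd0, ← hcn, hc0]

/-- Moving the endpoint of a chain enlarges the admissible error by the displacement. -/
theorem ChainFrom.perturb_right {X ι : Type*} [MetricSpace X] {f : ι → X → X} {δ η : ℝ}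
    {a b b' : X} {n : ℕ} (hn : 0 < n) (h : ChainFrom f δ a b n) (hb : dist b b' ≤ η) :
    ChainFrom f (δ + η) a b' n := by
  obtain ⟨w, rfl, c, hc, hc0, hcn⟩ := h
  refine ⟨w, rfl, Function.update c w.length b', ?_, ?_, by simp⟩
  · intro j hj
    have h := hc j hj
    rw [Function.update_of_ne hj.ne]
    by_cases hj' : j + 1 = w.length
    · rw [hj', Function.update_self]
      rw [hj', hcn] at h
      exact (dist_triangle _ _ _).trans (add_le_add h hb)
    · rw [Function.update_of_ne hj']
      exact h.trans (le_add_of_nonneg_right (dist_nonneg.trans hb))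
  · rw [Function.update_of_ne hn.ne, hc0]

theorem RelEps.trans {X ι : Type*} [MetricSpace X] {f : ι → X → X} {ε : ℝ} {k : ℕ} {x y z : X}
    (h₁ : RelEps f ε k x y) (h₂ : RelEps f ε k y z) : RelEps f ε k x z := by
  obtain ⟨n, hn, hkn, hc⟩ := h₁
  obtain ⟨l, -, hkl, hd⟩ := h₂
  exact ⟨n + l, by omega, dvd_add hkn hkl, hc.trans hd⟩

theorem RelEps.of_dist_le {X ι : Type*} [MetricSpace X] {f : ι → X → X}
    (hct : ChainTransitive f) {ε : ℝ} (hε : 0 < ε) {k : ℕ}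
    (hk : ∀ x : X, IsGCDOf (Tset f ε x) k) {x y : X} (h : dist x y ≤ ε / 2) :
    RelEps f ε k x y := by
  obtain ⟨n, hn, hc⟩ := hct (ε / 2) (half_pos hε) x x
  have key : ∀ z, dist x z ≤ ε / 2 → ChainFrom f ε x z n := fun z hz => by
    simpa using hc.perturb_right hn hz
  exact ⟨n, hn, (hk x).1 n ⟨hn, key x (by simpa using (half_pos hε).le)⟩, key y h⟩

/-- A set containing, with each of its points, the ball of a fixed radius is clopen. -/
theorem isClopen_of_uniform_ball {Z : Type*} [PseudoMetricSpace Z] {S : Set Z} {δ : ℝ}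
    (hδ : 0 < δ) (h : ∀ p ∈ S, ∀ q, dist q p < δ → q ∈ S) : IsClopen S := by
  refine ⟨⟨Metric.isOpen_iff.2 fun p hp => ⟨δ, hδ, fun q hq hqS => ?_⟩⟩,
    Metric.isOpen_iff.2 fun p hp => ⟨δ, hδ, fun q hq => h p hp q hq⟩⟩
  exact hp (h q hqS p (by simpa [dist_comm] using hq))

theorem stmt14 {X : Type*} [MetricSpace X] [CompactSpace X] {m : ℕ}
    (f : Fin m → X → X) (hf : ∀ i, Continuous (f i)) (hct : ChainTransitive f) :
    (∀ ε : ℝ, 0 < ε → ∀ k : ℕ, (∀ x : X, IsGCDOf (Tset f ε x) k) →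
      (∀ x : X, IsClopen {y : X | RelEps f ε k x y}) ∧
        IsClopen {p : X × X | RelEps f ε k p.1 p.2}) ∧
      IsClosed {p : X × X | ∀ ε : ℝ, 0 < ε → ∀ k : ℕ,
        (∀ x : X, IsGCDOf (Tset f ε x) k) → RelEps f ε k p.1 p.2} := by
  have hclopen : ∀ ε : ℝ, 0 < ε → ∀ k : ℕ, (∀ x : X, IsGCDOf (Tset f ε x) k) →
      IsClopen {p : X × X | RelEps f ε k p.1 p.2} := by
    intro ε hε k hk
    refine isClopen_of_uniform_ball (half_pos hε) ?_
    rintro ⟨x, y⟩ hxy ⟨x', y'⟩ hd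
    rw [Prod.dist_eq, max_lt_iff] at hd
    obtain ⟨hx, hy⟩ := hd
    rw [dist_comm] at hy
    exact ((RelEps.of_dist_le hct hε hk hx.le).trans hxy).trans
      (RelEps.of_dist_le hct hε hk hy.le)
  refine ⟨fun ε hε k hk => ⟨fun x => ?_, hclopen ε hε k hk⟩, ?_⟩
  · exact (hclopen ε hε k hk).preimage (by fun_prop : Continuous fun y : X => (x, y))
  · simp only [ofPred_forall]
    exact isClosed_iInter fun ε => isClosed_iInter fun hε => isClosed_iInter fun k =>
      isClosed_iInter fun hk => (hclopen ε hε k hk).1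
end
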